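/- arXiv:2209.08974 — 2 statements merged into one kernel-verified Lean document; each statement's English description precedes it below -/
import Mathlib

section
/- For every cubical complex Q in ℝ², the rank of the zeroth homology group H₀(Q) = D₀ / im ∂₁ equals the number of connected components of the union |Q| = ⋃_{q ∈ Q} q ⊆ ℝ² with its subspace topology. -/
open scoped Classical

/-- An elementary interval is a closed subset of `ℝ` of the form `[e, e+1]`
(non-degenerate) or `[e, e] = {e}` (degenerate) for some integer `e`. -/
def IsElementaryInterval (E : Set ℝ) : Prop :=
  ∃ e : ℤ, E = Set.Icc (e : ℝ) (e + 1) ∨ E = {(e : ℝ)}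

/-- An elementary cube in `ℝ²` is a product `E₁ ×ˢ E₂` of two elementary intervals. -/
def IsElementaryCube (q : Set (ℝ × ℝ)) : Prop :=
  ∃ E₁ E₂ : Set ℝ, IsElementaryInterval E₁ ∧ IsElementaryInterval E₂ ∧ q = E₁ ×ˢ E₂

/-- A cubical complex in `ℝ²`. -/
def IsCubicalComplex (Q : Set (Set (ℝ × ℝ))) : Prop :=
  Q.Finite ∧ (∀ q ∈ Q, IsElementaryCube q) ∧
    (∀ q ∈ Q, ∀ q' : Set (ℝ × ℝ), IsElementaryCube q' → q' ⊆ q → q' ∈ Q) ∧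
    (∀ q ∈ Q, ∀ q' ∈ Q, (q ∩ q').Nonempty → q ∩ q' ∈ Q)

/-- The vertex `{v} × {w}` at the grid point `p = (v, w)`. -/
def vertCube (p : ℤ × ℤ) : Set (ℝ × ℝ) :=
  ({(p.1 : ℝ)} : Set ℝ) ×ˢ ({(p.2 : ℝ)} : Set ℝ)

/-- The horizontal edge `[v, v+1] × {w}` based at the grid point `p = (v, w)`. -/
def hEdgeCube (p : ℤ × ℤ) : Set (ℝ × ℝ) :=
  Set.Icc (p.1 : ℝ) (p.1 + 1) ×ˢ ({(p.2 : ℝ)} : Set ℝ)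

/-- The vertical edge `{v} × [w, w+1]` based at the grid point `p = (v, w)`. -/
def vEdgeCube (p : ℤ × ℤ) : Set (ℝ × ℝ) :=
  ({(p.1 : ℝ)} : Set ℝ) ×ˢ Set.Icc (p.2 : ℝ) (p.2 + 1)

/-- Edges are indexed by a base grid point together with a direction:
`false` for horizontal, `true` for vertical. -/
def edgeCube (e : (ℤ × ℤ) × Bool) : Set (ℝ × ℝ) :=
  if e.2 then vEdgeCube e.1 else hEdgeCube e.1

/-- The square `[v, v+1] × [w, w+1]` based at the grid point `p = (v, w)`. -/
def sqCube (p : ℤ × ℤ) : Set (ℝ × ℝ) :=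
  Set.Icc (p.1 : ℝ) (p.1 + 1) ×ˢ Set.Icc (p.2 : ℝ) (p.2 + 1)

/-- `D₀`: the free abelian group on the vertices of `Q`. -/
abbrev D0 (Q : Set (Set (ℝ × ℝ))) : Type :=
  {p : ℤ × ℤ // vertCube p ∈ Q} →₀ ℤ

/-- `D₁`: the free abelian group on the edges of `Q`. -/
abbrev D1 (Q : Set (Set (ℝ × ℝ))) : Type :=
  {e : (ℤ × ℤ) × Bool // edgeCube e ∈ Q} →₀ ℤ

/-- `D₂`: the free abelian group on the squares of `Q`. -/
abbrev D2 (Q : Set (Set (ℝ × ℝ))) : Type :=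
  {p : ℤ × ℤ // sqCube p ∈ Q} →₀ ℤ

/-- The generator of `D₀` corresponding to the vertex at `p` (and `0` if this vertex
does not belong to `Q`; for a cubical complex every vertex of a cube of `Q` is in `Q`,
so this case does not occur for the generator images used below). -/
noncomputable def vGen (Q : Set (Set (ℝ × ℝ))) (p : ℤ × ℤ) : D0 Q :=
  if h : vertCube p ∈ Q then Finsupp.single ⟨p, h⟩ 1 else 0

/-- The generator of `D₁` corresponding to the edge `e` (and `0` if it is not in `Q`). -/
noncomputable def eGen (Q : Set (Set (ℝ × ℝ))) (e : (ℤ × ℤ) × Bool) : D1 Q :=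
  if h : edgeCube e ∈ Q then Finsupp.single ⟨e, h⟩ 1 else 0

/-- The boundary `∂₁` on a single edge:
`∂₁([v,v+1] × {w}) = ({v+1} × {w}) − ({v} × {w})` and
`∂₁({v} × [w,w+1]) = ({v} × {w+1}) − ({v} × {w})`. -/
noncomputable def edgeBoundary (Q : Set (Set (ℝ × ℝ))) (e : (ℤ × ℤ) × Bool) : D0 Q :=
  if e.2 then vGen Q (e.1.1, e.1.2 + 1) - vGen Q e.1
  else vGen Q (e.1.1 + 1, e.1.2) - vGen Q e.1

/-- The boundary homomorphism `∂₁ : D₁ → D₀`, the `ℤ`-linear extension of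
`edgeBoundary`. -/
noncomputable def bd1 (Q : Set (Set (ℝ × ℝ))) : D1 Q →ₗ[ℤ] D0 Q :=
  Finsupp.linearCombination ℤ fun e => edgeBoundary Q e.1

/-- The boundary `∂₂` on a single square:
`∂₂([v,v+1] × [w,w+1]) = ({v+1} × [w,w+1]) − ({v} × [w,w+1])
  + ([v,v+1] × {w}) − ([v,v+1] × {w+1})`. -/
noncomputable def sqBoundary (Q : Set (Set (ℝ × ℝ))) (p : ℤ × ℤ) : D1 Q :=
  eGen Q ((p.1 + 1, p.2), true) - eGen Q (p, true)
    + eGen Q (p, false) - eGen Q ((p.1, p.2 + 1), false)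

/-- The boundary homomorphism `∂₂ : D₂ → D₁`, the `ℤ`-linear extension of
`sqBoundary`. -/
noncomputable def bd2 (Q : Set (Set (ℝ × ℝ))) : D2 Q →ₗ[ℤ] D1 Q :=
  Finsupp.linearCombination ℤ fun s => sqBoundary Q s.1


open scoped TensorProduct

/-- The zeroth homology group `H₀(Q) := D₀ / im ∂₁`. -/
abbrev H0 (Q : Set (Set (ℝ × ℝ))) : Type :=
  D0 Q ⧸ LinearMap.range (bd1 Q)

def gridPt (p : ℤ × ℤ) : ℝ × ℝ := ((p.1 : ℝ), (p.2 : ℝ))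

noncomputable def vCls (Q : Set (Set (ℝ × ℝ))) (p : ℤ × ℤ) : H0 Q :=
  (LinearMap.range (bd1 Q)).mkQ (vGen Q p)

lemma gridPt_mem_vertCube (p : ℤ × ℤ) : gridPt p ∈ vertCube p := by
  simp [gridPt, vertCube]

lemma interval_form {E : Set ℝ} (h : IsElementaryInterval E) :
    ∃ a b : ℤ, a ≤ b ∧ b ≤ a + 1 ∧ E = Set.Icc (a : ℝ) b := by
  obtain ⟨e, rfl | rfl⟩ := h
  · exact ⟨e, e + 1, by omega, le_refl _, by push_cast; rfl⟩
  · exact ⟨e, e, le_refl _, by omega, by simp⟩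

lemma cube_form {q : Set (ℝ × ℝ)} (h : IsElementaryCube q) :
    ∃ a b c d : ℤ, a ≤ b ∧ b ≤ a + 1 ∧ c ≤ d ∧ d ≤ c + 1 ∧
      q = Set.Icc (a : ℝ) b ×ˢ Set.Icc (c : ℝ) d := by
  obtain ⟨E₁, E₂, h₁, h₂, rfl⟩ := h
  obtain ⟨a, b, h1, h2, rfl⟩ := interval_form h₁
  obtain ⟨c, d, h3, h4, rfl⟩ := interval_form h₂
  exact ⟨a, b, c, d, h1, h2, h3, h4, rfl⟩

lemma cube_exists_gridPt {q : Set (ℝ × ℝ)} (h : IsElementaryCube q) :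
    ∃ p, gridPt p ∈ q := by
  obtain ⟨a, b, c, d, h1, h2, h3, h4, rfl⟩ := cube_form h
  refine ⟨(a, c), ?_⟩
  simp [gridPt, h1, h3]

lemma cube_isClosed {q : Set (ℝ × ℝ)} (h : IsElementaryCube q) : IsClosed q := by
  obtain ⟨a, b, c, d, h1, h2, h3, h4, rfl⟩ := cube_form h
  exact isClosed_Icc.prod isClosed_Icc

lemma cube_isPreconnected {q : Set (ℝ × ℝ)} (h : IsElementaryCube q) : IsPreconnected q := by
  obtain ⟨a, b, c, d, h1, h2, h3, h4, rfl⟩ := cube_form h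
  exact isPreconnected_Icc.prod isPreconnected_Icc

lemma vertCube_elem (p : ℤ × ℤ) : IsElementaryCube (vertCube p) :=
  ⟨_, _, ⟨p.1, Or.inr rfl⟩, ⟨p.2, Or.inr rfl⟩, rfl⟩

lemma vertCube_mem {Q : Set (Set (ℝ × ℝ))} (hQ : IsCubicalComplex Q) {q : Set (ℝ × ℝ)}
    (hq : q ∈ Q) {p : ℤ × ℤ} (hp : gridPt p ∈ q) : vertCube p ∈ Q := by
  refine hQ.2.2.1 q hq _ (vertCube_elem p) ?_
  rintro ⟨x, y⟩ h
  simp only [vertCube, Set.mem_prod, Set.mem_singleton_iff] at h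
  obtain ⟨rfl, rfl⟩ := h
  exact hp

lemma vCls_hEdge {Q : Set (Set (ℝ × ℝ))} {p : ℤ × ℤ} (h : hEdgeCube p ∈ Q) :
    vCls Q (p.1 + 1, p.2) = vCls Q p := by
  rw [vCls, vCls, ← sub_eq_zero, ← map_sub, Submodule.mkQ_apply, Submodule.Quotient.mk_eq_zero]
  refine ⟨Finsupp.single ⟨(p, false), by simpa [edgeCube] using h⟩ 1, ?_⟩
  simp [bd1, edgeBoundary]

lemma vCls_vEdge {Q : Set (Set (ℝ × ℝ))} {p : ℤ × ℤ} (h : vEdgeCube p ∈ Q) :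
    vCls Q (p.1, p.2 + 1) = vCls Q p := by
  rw [vCls, vCls, ← sub_eq_zero, ← map_sub, Submodule.mkQ_apply, Submodule.Quotient.mk_eq_zero]
  refine ⟨Finsupp.single ⟨(p, true), by simpa [edgeCube] using h⟩ 1, ?_⟩
  simp [bd1, edgeBoundary]

lemma vCls_eq {Q : Set (Set (ℝ × ℝ))} (hQ : IsCubicalComplex Q) {q : Set (ℝ × ℝ)}
    (hq : q ∈ Q) {p p' : ℤ × ℤ} (hp : gridPt p ∈ q) (hp' : gridPt p' ∈ q) :
    vCls Q p = vCls Q p' := by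
  obtain ⟨a, b, c, d, h1, h2, h3, h4, rfl⟩ := cube_form (hQ.2.1 q hq)
  suffices H : ∀ p : ℤ × ℤ, gridPt p ∈ Set.Icc (a : ℝ) b ×ˢ Set.Icc (c : ℝ) d →
      vCls Q p = vCls Q (a, c) by rw [H p hp, H p' hp']
  rintro ⟨i, j⟩ hij
  simp only [gridPt, Set.mem_prod, Set.mem_Icc, Int.cast_le] at hij
  obtain ⟨⟨hi1, hi2⟩, hj1, hj2⟩ := hij
  have s1 : vCls Q (i, j) = vCls Q (a, j) := by
    rcases hi1.eq_or_lt with rfl | hlt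
    · rfl
    · obtain rfl : i = a + 1 := by omega
      obtain rfl : b = a + 1 := by omega
      refine vCls_hEdge (p := (a, j)) (hQ.2.2.1 _ hq _
        ⟨_, _, ⟨a, Or.inl rfl⟩, ⟨j, Or.inr rfl⟩, rfl⟩ ?_)
      refine Set.prod_mono (by push_cast; exact subset_rfl) ?_
      simp [hj1, hj2]
  have s2 : vCls Q (a, j) = vCls Q (a, c) := by
    rcases hj1.eq_or_lt with rfl | hlt
    · rfl
    · obtain rfl : j = c + 1 := by omega
      obtain rfl : d = c + 1 := by omega
      refine vCls_vEdge (p := (a, c)) (hQ.2.2.1 _ hq _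
        ⟨_, _, ⟨a, Or.inr rfl⟩, ⟨c, Or.inl rfl⟩, rfl⟩ ?_)
      refine Set.prod_mono ?_ (by push_cast; exact subset_rfl)
      simp [h1]
  rw [s1, s2]

/-- The locally constant class function on the union. -/
lemma exists_locConst {Q : Set (Set (ℝ × ℝ))} (hQ : IsCubicalComplex Q) :
    ∃ f : (⋃₀ Q : Set (ℝ × ℝ)) → H0 Q, IsLocallyConstant f ∧
      ∀ x : (⋃₀ Q : Set (ℝ × ℝ)), ∀ q ∈ Q, x.1 ∈ q → ∀ p, gridPt p ∈ q → f x = vCls Q p := by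
  have h : ∀ x : (⋃₀ Q : Set (ℝ × ℝ)), ∃ c : H0 Q,
      ∀ q ∈ Q, x.1 ∈ q → ∀ p, gridPt p ∈ q → c = vCls Q p := by
    rintro ⟨x, q, hq, hx⟩
    obtain ⟨p, hp⟩ := cube_exists_gridPt (hQ.2.1 q hq)
    refine ⟨vCls Q p, fun q' hq' hx' p' hp' => ?_⟩
    have hi := hQ.2.2.2 q hq q' hq' ⟨x, hx, hx'⟩
    obtain ⟨r, hr⟩ := cube_exists_gridPt (hQ.2.1 _ hi)
    rw [vCls_eq hQ hq hp hr.1, vCls_eq hQ hq' hr.2 hp']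
  choose f hf using h
  refine ⟨f, ?_, hf⟩
  have key : ∀ s : Set (H0 Q), IsClosed (f ⁻¹' s) := by
    intro s
    have : f ⁻¹' s = ⋃ q ∈ {q ∈ Q | ∃ p, gridPt p ∈ q ∧ vCls Q p ∈ s},
        (Subtype.val ⁻¹' q : Set (⋃₀ Q : Set (ℝ × ℝ))) := by
      ext x
      simp only [Set.mem_preimage, Set.mem_iUnion, Set.mem_setOf_eq, exists_prop]
      constructor
      · intro hx
        obtain ⟨q, hq, hxq⟩ := x.2
        obtain ⟨p, hp⟩ := cube_exists_gridPt (hQ.2.1 q hq)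
        exact ⟨q, ⟨hq, p, hp, hf x q hq hxq p hp ▸ hx⟩, hxq⟩
      · rintro ⟨q, ⟨hq, p, hp, hs⟩, hxq⟩
        rw [hf x q hq hxq p hp]
        exact hs
    rw [this]
    refine (hQ.1.subset (Set.sep_subset _ _)).isClosed_biUnion fun q hq => ?_
    exact (cube_isClosed (hQ.2.1 q hq.1)).preimage continuous_subtype_val
  intro s
  simpa using (key sᶜ).isOpen_compl

lemma mk_eq_of_cube {Q : Set (Set (ℝ × ℝ))} (hQ : IsCubicalComplex Q) {q : Set (ℝ × ℝ)}
    (hq : q ∈ Q) (x y : (⋃₀ Q : Set (ℝ × ℝ))) (hx : x.1 ∈ q) (hy : y.1 ∈ q) :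
    ConnectedComponents.mk x = ConnectedComponents.mk y := by
  rw [ConnectedComponents.coe_eq_coe']
  have hpre : IsPreconnected (Subtype.val ⁻¹' q : Set (⋃₀ Q : Set (ℝ × ℝ))) := by
    rw [← Topology.IsInducing.subtypeVal.isPreconnected_image, Subtype.image_preimage_coe,
      Set.inter_eq_right.2 (Set.subset_sUnion_of_mem hq)]
    exact cube_isPreconnected (hQ.2.1 q hq)
  exact hpre.subset_connectedComponent hy hx

def vComp (Q : Set (Set (ℝ × ℝ))) (p : {p : ℤ × ℤ // vertCube p ∈ Q}) :
    ConnectedComponents (⋃₀ Q : Set (ℝ × ℝ)) :=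
  ConnectedComponents.mk ⟨gridPt p.1, vertCube p.1, p.2, gridPt_mem_vertCube p.1⟩

lemma lmap_vGen {Q : Set (Set (ℝ × ℝ))} {p : ℤ × ℤ} (h : vertCube p ∈ Q) :
    Finsupp.lmapDomain ℤ ℤ (vComp Q) (vGen Q p) = Finsupp.single (vComp Q ⟨p, h⟩) 1 := by
  simp [vGen, h]

lemma lmap_sub {Q : Set (Set (ℝ × ℝ))} (hQ : IsCubicalComplex Q) {q : Set (ℝ × ℝ)}
    (hq : q ∈ Q) {p p' : ℤ × ℤ} (hp : gridPt p ∈ q) (hp' : gridPt p' ∈ q) :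
    Finsupp.lmapDomain ℤ ℤ (vComp Q) (vGen Q p - vGen Q p') = 0 := by
  rw [map_sub, lmap_vGen (vertCube_mem hQ hq hp), lmap_vGen (vertCube_mem hQ hq hp'),
    sub_eq_zero]
  congr 1
  exact mk_eq_of_cube hQ hq _ _ hp hp'

lemma range_le_ker {Q : Set (Set (ℝ × ℝ))} (hQ : IsCubicalComplex Q) :
    LinearMap.range (bd1 Q) ≤ LinearMap.ker (Finsupp.lmapDomain ℤ ℤ (vComp Q)) := by
  rw [bd1, Finsupp.range_linearCombination, Submodule.span_le]
  rintro _ ⟨⟨⟨⟨v, w⟩, b⟩, he⟩, rfl⟩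
  rw [SetLike.mem_coe, LinearMap.mem_ker]
  cases b
  · simp only [edgeBoundary, Bool.false_eq_true, if_false]
    exact lmap_sub hQ he (by simp [edgeCube, hEdgeCube, gridPt])
      (by simp [edgeCube, hEdgeCube, gridPt])
  · simp only [edgeBoundary, if_true]
    exact lmap_sub hQ he (by simp [edgeCube, vEdgeCube, gridPt])
      (by simp [edgeCube, vEdgeCube, gridPt])

lemma nonempty_equiv {Q : Set (Set (ℝ × ℝ))} (hQ : IsCubicalComplex Q) :
    Nonempty (H0 Q ≃ₗ[ℤ] (ConnectedComponents (⋃₀ Q : Set (ℝ × ℝ)) →₀ ℤ)) := by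
  obtain ⟨f, hf, hfp⟩ := exists_locConst hQ
  have hF : ∃ F : ConnectedComponents (⋃₀ Q : Set (ℝ × ℝ)) → H0 Q,
      ∀ x, F (ConnectedComponents.mk x) = f x := by
    choose g hg using ConnectedComponents.surjective_coe (α := (⋃₀ Q : Set (ℝ × ℝ)))
    refine ⟨fun c => f (g c), fun x => ?_⟩
    refine hf.apply_eq_of_isPreconnected (isPreconnected_connectedComponent (x := x)) ?_
      mem_connectedComponent
    exact ConnectedComponents.coe_eq_coe'.1 (hg _)
  obtain ⟨F, hF⟩ := hF
  have hFv : ∀ p, F (vComp Q p) = vCls Q p.1 := fun p => by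
    rw [vComp, hF]
    exact hfp _ _ p.2 (gridPt_mem_vertCube _) _ (gridPt_mem_vertCube _)
  have hmk : ∀ p : {p : ℤ × ℤ // vertCube p ∈ Q},
      (LinearMap.range (bd1 Q)).mkQ (Finsupp.single p 1) = vCls Q p.1 := fun p => by
    simp [vCls, vGen, p.2]
  refine ⟨LinearEquiv.ofLinear
    ((LinearMap.range (bd1 Q)).liftQ (Finsupp.lmapDomain ℤ ℤ (vComp Q)) (range_le_ker hQ))
    (Finsupp.linearCombination ℤ F) ?_ ?_⟩
  · refine Finsupp.lhom_ext' fun c => LinearMap.ext_ring ?_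
    obtain ⟨⟨x, q, hq, hx⟩, rfl⟩ := ConnectedComponents.surjective_coe c
    obtain ⟨p, hp⟩ := cube_exists_gridPt (hQ.2.1 q hq)
    have hc : ConnectedComponents.mk (⟨x, q, hq, hx⟩ : (⋃₀ Q : Set (ℝ × ℝ))) =
        vComp Q ⟨p, vertCube_mem hQ hq hp⟩ := mk_eq_of_cube hQ hq _ _ hx hp
    rw [hc]
    simp only [LinearMap.comp_apply, Finsupp.lsingle_apply, Finsupp.linearCombination_single,
      one_smul, hFv, LinearMap.id_apply]
    rw [vCls, Submodule.mkQ_apply, Submodule.liftQ_apply, lmap_vGen (vertCube_mem hQ hq hp)]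
  · refine Submodule.linearMap_qext _ (Finsupp.lhom_ext' fun p => LinearMap.ext_ring ?_)
    simp only [LinearMap.comp_apply, Finsupp.lsingle_apply, LinearMap.id_apply]
    rw [hmk, ← hmk, Submodule.mkQ_apply, Submodule.liftQ_apply, Finsupp.lmapDomain_apply,
      Finsupp.mapDomain_single, Finsupp.linearCombination_single, one_smul, hFv, ← hmk,
      Submodule.mkQ_apply]

/-- For every cubical complex `Q` in `ℝ²`, the rank of the zeroth homology group
`H₀(Q) = D₀ / im ∂₁` (the rank of a finitely generated abelian group `A` being
`dim_ℚ (ℚ ⊗_ℤ A)`) equals the number of connected components of the union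
`|Q| = ⋃ q ∈ Q, q ⊆ ℝ²` with its subspace topology. -/
theorem rank_H0_eq_card_connectedComponents (Q : Set (Set (ℝ × ℝ)))
    (hQ : IsCubicalComplex Q) :
    Module.rank ℚ (ℚ ⊗[ℤ] H0 Q) =
      Cardinal.mk (ConnectedComponents (⋃₀ Q : Set (ℝ × ℝ))) := by
  obtain ⟨e⟩ := nonempty_equiv hQ
  rw [(e.baseChange ℤ ℚ _ _).rank_eq, Module.rank_baseChange]
  simp
end

section
/- For every cubical complex Q in ℝ², the rank of the first homology group H₁(Q) = ker ∂₁ / im ∂₂ equals the number of bounded connected components (enclosed regions) of the complement ℝ² \ |Q|, where |Q| = ⋃_{q ∈ Q} q. -/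
open scoped Classical

open scoped TensorProduct

/-- The first homology group `H₁(Q) := ker ∂₁ / im ∂₂`.  (The image of `∂₂` is viewed
as a submodule of `ker ∂₁` by pulling `range ∂₂` back along the inclusion
`ker ∂₁ ⊆ D₁`; for a cubical complex `∂₁ ∘ ∂₂ = 0`, so `range ∂₂ ⊆ ker ∂₁` and this
pullback is exactly `im ∂₂`.) -/
abbrev H1 (Q : Set (Set (ℝ × ℝ))) : Type :=
  LinearMap.ker (bd1 Q) ⧸
    Submodule.comap (LinearMap.ker (bd1 Q)).subtype (LinearMap.range (bd2 Q))

/-! ### Combinatorial part -/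

/-- coefficient of the boundary of a 2-chain of the whole plane -/
def dl (f : ℤ × ℤ → ℤ) (e : (ℤ × ℤ) × Bool) : ℤ :=
  if e.2 then f (e.1.1 - 1, e.1.2) - f e.1 else f e.1 - f (e.1.1, e.1.2 - 1)

/-- coefficient of the boundary of a 1-chain of the whole plane -/
def dl1 (z : (ℤ × ℤ) × Bool → ℤ) (p : ℤ × ℤ) : ℤ :=
  z ((p.1, p.2 - 1), true) - z (p, true) + z ((p.1 - 1, p.2), false) - z (p, false)

theorem dl1_dl (f : ℤ × ℤ → ℤ) (p : ℤ × ℤ) : dl1 (dl f) p = 0 := by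
  simp [dl1, dl]; ring

theorem dl_eq_zero (f : ℤ × ℤ → ℤ) (h : ∀ e, dl f e = 0) (s t : ℤ × ℤ) : f s = f t := by
  have h1 : ∀ b a : ℤ, f (a, b) = f (0, b) := by
    intro b a
    induction a using Int.induction_on with
    | zero => rfl
    | succ i ih =>
      have := h (((i : ℤ) + 1, b), true)
      simp [dl] at this; linarith
    | pred i ih =>
      have := h ((-(i : ℤ), b), true)
      simp [dl] at this; linarith
  have h2 : ∀ b : ℤ, f (0, b) = f (0, 0) := by
    intro b
    induction b using Int.induction_on with
    | zero => rfl
    | succ i ih =>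
      have := h ((0, (i : ℤ) + 1), false)
      simp [dl] at this; linarith
    | pred i ih =>
      have := h ((0, -(i : ℤ)), false)
      simp [dl] at this; linarith
  obtain ⟨a, b⟩ := s
  obtain ⟨c, d⟩ := t
  rw [h1, h2, h1 d c, h2 d]

theorem int_const (g : ℤ → ℤ) (h : ∀ a, g a = g (a - 1)) (a b : ℤ) : g a = g b := by
  have h1 : ∀ a : ℤ, g a = g 0 := by
    intro a
    induction a using Int.induction_on with
    | zero => rfl
    | succ i ih =>
      have := h ((i : ℤ) + 1)
      simp at this; linarith
    | pred i ih =>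
      have := h (-(i : ℤ))
      linarith
  rw [h1, h1 b]

theorem exists_primitive (z : (ℤ × ℤ) × Bool → ℤ) (N : ℤ)
    (hN : ∀ e, z e ≠ 0 → |e.1.1| ≤ N ∧ |e.1.2| ≤ N) (hz : ∀ p, dl1 z p = 0) :
    ∃ f : ℤ × ℤ → ℤ, (∀ s, f s ≠ 0 → |s.1| ≤ N ∧ |s.2| ≤ N) ∧ ∀ e, dl f e = z e := by
  set f : ℤ × ℤ → ℤ := fun s => -∑ i ∈ Finset.Ioc (-N - 1) s.1, z ((i, s.2), true) with hf
  have hN' : ∀ a b c, ¬ (|a| ≤ N ∧ |b| ≤ N) → z ((a, b), c) = 0 := by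
    intro a b c h
    by_contra h'
    exact h (hN _ h')
  have hlow : ∀ a b, a < -N → f (a, b) = 0 := by
    intro a b h
    have : Finset.Ioc (-N - 1) a = ∅ := by
      apply Finset.Ioc_eq_empty; omega
    simp [hf, this]
  have hb : ∀ a b, ¬ |b| ≤ N → f (a, b) = 0 := by
    intro a b h
    simp only [hf, neg_eq_zero]
    apply Finset.sum_eq_zero
    intro i _
    exact hN' _ _ _ (fun h' => h h'.2)
  have hv : ∀ a b, f (a - 1, b) - f (a, b) = z ((a, b), true) := by
    intro a b
    by_cases h : a < -N
    · rw [hlow _ _ h, hlow _ _ (by omega), hN']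
      · rfl
      · intro h'
        have := (abs_le.1 h'.1).1
        omega
    · have : Finset.Ioc (-N - 1) a = insert a (Finset.Ioc (-N - 1) (a - 1)) := by
        ext i; simp; omega
      simp only [hf, this]
      rw [Finset.sum_insert (by simp)]
      ring
  have hh : ∀ a b, f (a, b) - f (a, b - 1) = z ((a, b), false) := by
    intro a b
    have key := int_const (fun a => f (a, b) - f (a, b - 1) - z ((a, b), false)) (by
      intro a
      have h1 := hv a b
      have h2 := hv a (b - 1)
      have h3 := hz (a, b)
      simp [dl1] at h3
      try simp only
      linarith) a (-N - 1)
    try simp only at key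
    rw [hlow (-N - 1) _ (by omega), hlow (-N - 1) _ (by omega), hN' (-N - 1) b] at key
    · linarith
    · intro h'
      have := (abs_le.1 h'.1).1
      omega
  refine ⟨f, ?_, ?_⟩
  · rintro ⟨a, b⟩ h
    constructor
    · by_contra hc
      apply h
      try simp only at hc
      have key := int_const (fun b => f (a, b)) (by
        intro b
        have := hh a b
        rw [hN' _ _ _ (fun h' => hc h'.1)] at this
        try simp only
        linarith) b (|N| + 1)
      try simp only at key
      rw [key, hb]
      intro h'
      have := le_abs_self (|N| + 1)
      have := le_abs_self N
      omega
    · by_contra hc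
      exact h (hb _ _ hc)
  · rintro ⟨⟨a, b⟩, c⟩
    cases c
    · simpa [dl] using hh a b
    · simpa [dl] using hv a b

/-- extension by zero -/
noncomputable def extz {α : Type} {P : α → Prop} (x : {a // P a} →₀ ℤ) (a : α) : ℤ :=
  if h : P a then x ⟨a, h⟩ else 0

theorem extz_add {α : Type} {P : α → Prop} (x y : {a // P a} →₀ ℤ) (a : α) :
    extz (x + y) a = extz x a + extz y a := by
  unfold extz; split_ifs <;> simp

theorem extz_sub {α : Type} {P : α → Prop} (x y : {a // P a} →₀ ℤ) (a : α) :
    extz (x - y) a = extz x a - extz y a := by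
  unfold extz; split_ifs <;> simp

theorem extz_smul {α : Type} {P : α → Prop} (n : ℤ) (y : {a // P a} →₀ ℤ) (a : α) :
    extz (n • y) a = n * extz y a := by
  unfold extz; split_ifs <;> simp

theorem extz_zero {α : Type} {P : α → Prop} (a : α) :
    extz (0 : {a // P a} →₀ ℤ) a = 0 := by
  unfold extz; split_ifs <;> simp

theorem extz_not {α : Type} {P : α → Prop} (x : {a // P a} →₀ ℤ) (a : α) (h : ¬ P a) :
    extz x a = 0 := by
  simp [extz, h]

theorem extz_single {α : Type} {P : α → Prop} (b : {a // P a}) (n : ℤ) (a : α) :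
    extz (Finsupp.single b n) a = if a = b.1 then n else 0 := by
  unfold extz
  by_cases hab : a = b.1
  · subst hab
    simp [b.2]
  · simp only [hab, if_false]
    split_ifs with h
    · rw [Finsupp.single_apply, if_neg]
      intro h'; apply hab; rw [h']
    · rfl

theorem extz_inj {α : Type} {P : α → Prop} {x y : {a // P a} →₀ ℤ}
    (h : ∀ a, P a → extz x a = extz y a) : x = y := by
  ext ⟨a, ha⟩
  simpa [extz, ha] using h a ha

theorem extz_vGen (Q) (p q : ℤ × ℤ) (hq : vertCube q ∈ Q) :
    extz (vGen Q p) q = if q = p then 1 else 0 := by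
  unfold vGen
  split_ifs with h h' h'
  · rw [extz_single]; simp [h']
  · rw [extz_single]; simp [h']
  · subst h'; exact absurd hq h
  · exact extz_zero _

theorem extz_eGen (Q) (p q : (ℤ × ℤ) × Bool) (hq : edgeCube q ∈ Q) :
    extz (eGen Q p) q = if q = p then 1 else 0 := by
  unfold eGen
  split_ifs with h h' h'
  · rw [extz_single]; simp [h']
  · rw [extz_single]; simp [h']
  · subst h'; exact absurd hq h
  · exact extz_zero _

theorem extz_bd1 (Q) (x : D1 Q) (p : ℤ × ℤ) (hp : vertCube p ∈ Q) :
    extz (bd1 Q x) p = dl1 (extz x) p := by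
  induction x using Finsupp.induction_linear with
  | zero => simp [extz_zero, dl1]
  | add x y hx hy =>
    rw [map_add, extz_add, hx, hy]
    simp only [dl1, extz_add]; ring
  | single e n =>
    obtain ⟨⟨⟨a, b⟩, c⟩, he⟩ := e
    obtain ⟨u, v⟩ := p
    simp only [bd1, Finsupp.linearCombination_single, extz_smul, edgeBoundary, dl1, extz_single]
    cases c
    · simp only [Bool.false_eq_true, if_false, extz_sub, extz_vGen _ _ _ hp, Prod.mk.injEq,
        and_false, and_true, reduceCtorEq]
      by_cases h1 : v = b
      · by_cases h2 : u = a
        · have : ¬ (u - 1 = a) := by omega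
          have : ¬ (u = a + 1) := by omega
          simp [*]
        · by_cases h3 : u = a + 1
          · have : (u - 1 = a) := by omega
            simp [*]
          · have : ¬ (u - 1 = a) := by omega
            simp [*]
      · simp [h1]
    · simp only [if_true, extz_sub, extz_vGen _ _ _ hp, Prod.mk.injEq,
        and_false, and_true, reduceCtorEq]
      by_cases h1 : u = a
      · by_cases h2 : v = b
        · have : ¬ (v - 1 = b) := by omega
          have : ¬ (v = b + 1) := by omega
          simp [*]
        · by_cases h3 : v = b + 1
          · have : (v - 1 = b) := by omega
            simp [*]
          · have : ¬ (v - 1 = b) := by omega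
            simp [*]
      · simp [h1]

theorem extz_bd2 (Q) (x : D2 Q) (e : (ℤ × ℤ) × Bool) (hp : edgeCube e ∈ Q) :
    extz (bd2 Q x) e = dl (extz x) e := by
  induction x using Finsupp.induction_linear with
  | zero => simp [extz_zero, dl]
  | add x y hx hy =>
    rw [map_add, extz_add, hx, hy]
    simp only [dl, extz_add]; split_ifs <;> ring
  | single s n =>
    obtain ⟨⟨a, b⟩, he⟩ := s
    obtain ⟨⟨u, v⟩, c⟩ := e
    simp only [bd2, Finsupp.linearCombination_single, extz_smul, sqBoundary, dl, extz_single,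
      extz_sub, extz_add, extz_eGen _ _ _ hp]
    cases c
    · simp only [Bool.false_eq_true, if_false, Prod.mk.injEq,
        and_false, and_true, reduceCtorEq]
      by_cases h1 : u = a
      · by_cases h2 : v = b
        · have : ¬ (v - 1 = b) := by omega
          have : ¬ (v = b + 1) := by omega
          simp [*]
        · by_cases h3 : v = b + 1
          · have : (v - 1 = b) := by omega
            simp [*]
          · have : ¬ (v - 1 = b) := by omega
            simp [*]
      · simp [h1]
    · simp only [if_true, Prod.mk.injEq,
        and_false, and_true, reduceCtorEq]
      by_cases h1 : v = b
      · by_cases h2 : u = a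
        · have : ¬ (u - 1 = a) := by omega
          have : ¬ (u = a + 1) := by omega
          simp [*]
        · by_cases h3 : u = a + 1
          · have : (u - 1 = a) := by omega
            simp [*]
          · have : ¬ (u - 1 = a) := by omega
            simp [*]
      · simp [h1]

/-! ### Faces -/

theorem isElem_vert (p) : IsElementaryCube (vertCube p) :=
  ⟨_, _, ⟨p.1, Or.inr rfl⟩, ⟨p.2, Or.inr rfl⟩, rfl⟩

theorem isElem_edge (e) : IsElementaryCube (edgeCube e) := by
  unfold edgeCube
  split_ifs
  · exact ⟨_, _, ⟨e.1.1, Or.inr rfl⟩, ⟨e.1.2, Or.inl rfl⟩, rfl⟩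
  · exact ⟨_, _, ⟨e.1.1, Or.inl rfl⟩, ⟨e.1.2, Or.inr rfl⟩, rfl⟩

/-- the pair of squares adjacent to an edge -/
def prevSq (e : (ℤ × ℤ) × Bool) : ℤ × ℤ :=
  if e.2 then (e.1.1 - 1, e.1.2) else (e.1.1, e.1.2 - 1)

theorem edge_sub_sq (e) : edgeCube e ⊆ sqCube e.1 := by
  unfold edgeCube vEdgeCube hEdgeCube sqCube
  split_ifs
  · exact Set.prod_mono (by simp) subset_rfl
  · exact Set.prod_mono subset_rfl (by simp)

theorem edge_sub_prevSq (e) : edgeCube e ⊆ sqCube (prevSq e) := by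
  unfold edgeCube vEdgeCube hEdgeCube sqCube prevSq
  split_ifs
  · exact Set.prod_mono (by simp) subset_rfl
  · exact Set.prod_mono subset_rfl (by simp)

theorem dl_eq (f : ℤ × ℤ → ℤ) (e) :
    dl f e = if e.2 then f (prevSq e) - f e.1 else f e.1 - f (prevSq e) := by
  unfold dl prevSq; split_ifs <;> rfl

section
variable {Q : Set (Set (ℝ × ℝ))}

theorem edge_mem_of_sq (hQ : IsCubicalComplex Q) {e} (h : sqCube e.1 ∈ Q) : edgeCube e ∈ Q :=
  hQ.2.2.1 _ h _ (isElem_edge e) (edge_sub_sq e)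

theorem edge_mem_of_prevSq (hQ : IsCubicalComplex Q) {e} (h : sqCube (prevSq e) ∈ Q) :
    edgeCube e ∈ Q :=
  hQ.2.2.1 _ h _ (isElem_edge e) (edge_sub_prevSq e)

theorem vert_mem_of_edge (hQ : IsCubicalComplex Q) {e} {p} (h : edgeCube e ∈ Q)
    (hp : vertCube p ⊆ edgeCube e) : vertCube p ∈ Q :=
  hQ.2.2.1 _ h _ (isElem_vert p) hp

theorem extz_bd2' (hQ : IsCubicalComplex Q) (x : D2 Q) (e : (ℤ × ℤ) × Bool) :
    extz (bd2 Q x) e = dl (extz x) e := by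
  by_cases he : edgeCube e ∈ Q
  · exact extz_bd2 Q x e he
  · rw [extz_not (P := fun e => edgeCube e ∈ Q) _ _ he, dl_eq,
      extz_not (P := fun s => sqCube s ∈ Q) _ _ (fun h => he (edge_mem_of_sq hQ h)),
      extz_not (P := fun s => sqCube s ∈ Q) _ _ (fun h => he (edge_mem_of_prevSq hQ h))]
    simp

theorem dl1_extz_of_not (hQ : IsCubicalComplex Q) (x : D1 Q) (p) (hp : vertCube p ∉ Q) :
    dl1 (extz x) p = 0 := by
  unfold dl1
  rw [extz_not, extz_not, extz_not, extz_not]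
  · simp
  all_goals
    intro h
    refine hp (vert_mem_of_edge hQ h ?_)
    simp only [edgeCube, vertCube, hEdgeCube, vEdgeCube, if_true, Bool.false_eq_true, if_false]
    exact Set.prod_mono (by simp) (by simp)

theorem mem_ker_bd1 (hQ : IsCubicalComplex Q) (x : D1 Q) :
    bd1 Q x = 0 ↔ ∀ p, dl1 (extz x) p = 0 := by
  constructor
  · intro h p
    by_cases hp : vertCube p ∈ Q
    · rw [← extz_bd1 Q x p hp, h, extz_zero]
    · exact dl1_extz_of_not hQ x p hp
  · intro h
    apply extz_inj
    intro p hp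
    rw [extz_bd1 Q x p hp, h, extz_zero]

end

/-! ### Topological part -/

theorem mem_sqCube {p : ℝ × ℝ} {s : ℤ × ℤ} : p ∈ sqCube s ↔
    ((s.1 : ℝ) ≤ p.1 ∧ p.1 ≤ s.1 + 1) ∧ ((s.2 : ℝ) ≤ p.2 ∧ p.2 ≤ s.2 + 1) := by
  unfold sqCube
  rw [Set.mem_prod, Set.mem_Icc, Set.mem_Icc]

/-- center of a square -/
noncomputable def ctr (s : ℤ × ℤ) : ℝ × ℝ := ((s.1 : ℝ) + 1 / 2, (s.2 : ℝ) + 1 / 2)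

theorem ctr_mem (s) : ctr s ∈ sqCube s := by
  rw [mem_sqCube]
  simp only [ctr]
  refine ⟨⟨?_, ?_⟩, ?_, ?_⟩ <;> linarith

theorem elemInt_eq {E : Set ℝ} (hE : IsElementaryInterval E) {x : ℝ} (hx : x ∈ E) {a : ℤ}
    (h1 : (a : ℝ) < x) (h2 : x < a + 1) : E = Set.Icc (a : ℝ) (a + 1) := by
  obtain ⟨e, rfl | rfl⟩ := hE
  · obtain ⟨h3, h4⟩ := hx
    have h5 : (e : ℝ) < a + 1 := by linarith
    have h6 : (a : ℝ) < e + 1 := by linarith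
    have h5' : e < a + 1 := by exact_mod_cast h5
    have h6' : a < e + 1 := by exact_mod_cast h6
    have : e = a := by omega
    rw [this]
  · rw [Set.mem_singleton_iff] at hx
    subst hx
    have h1' : a < e := by exact_mod_cast h1
    have h2' : e < a + 1 := by exact_mod_cast h2
    omega

section
variable {Q : Set (Set (ℝ × ℝ))}

theorem eq_sqCube (hQ : IsCubicalComplex Q) {q} (hq : q ∈ Q) {p : ℝ × ℝ} (hp : p ∈ q) {s : ℤ × ℤ}
    (h1 : (s.1 : ℝ) < p.1) (h2 : p.1 < s.1 + 1) (h3 : (s.2 : ℝ) < p.2) (h4 : p.2 < s.2 + 1) :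
    sqCube s ∈ Q := by
  obtain ⟨E₁, E₂, hE₁, hE₂, rfl⟩ := hQ.2.1 q hq
  rw [elemInt_eq hE₁ hp.1 h1 h2, elemInt_eq hE₂ hp.2 h3 h4] at hq
  exact hq

theorem ctr_mem_U (hQ : IsCubicalComplex Q) {s} (hs : sqCube s ∉ Q) : ctr s ∈ (⋃₀ Q)ᶜ := by
  rintro ⟨q, hq, hp⟩
  apply hs
  apply eq_sqCube hQ hq hp <;> simp only [ctr] <;> linarith

theorem seg_sub (hQ : IsCubicalComplex Q) {p : ℝ × ℝ} (hp : p ∈ (⋃₀ Q)ᶜ) {s : ℤ × ℤ}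
    (hs : p ∈ sqCube s) : segment ℝ p (ctr s) ⊆ (⋃₀ Q)ᶜ := by
  rintro _ ⟨u, v, hu, hv, huv, rfl⟩
  rcases hv.eq_or_lt with rfl | hv
  · have : u = 1 := by linarith
    subst this
    simpa using hp
  · rintro ⟨q, hq, hpq⟩
    rw [mem_sqCube] at hs
    obtain ⟨⟨h1, h2⟩, h3, h4⟩ := hs
    have hu' : u = 1 - v := by linarith
    subst hu'
    refine hp ⟨sqCube s, eq_sqCube hQ hq hpq ?_ ?_ ?_ ?_, mem_sqCube.2 ⟨⟨h1, h2⟩, h3, h4⟩⟩ <;>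
      simp only [ctr, Prod.fst_add, Prod.snd_add, Prod.smul_fst, Prod.smul_snd, smul_eq_mul] <;>
      nlinarith

theorem not_sq_of_mem {p : ℝ × ℝ} (hp : p ∈ (⋃₀ Q)ᶜ) {s : ℤ × ℤ}
    (hs : p ∈ sqCube s) : sqCube s ∉ Q := fun h => hp ⟨_, h, hs⟩

/-- the component of the complement containing a square not in `Q` -/
noncomputable def sqComp (hQ : IsCubicalComplex Q) (s : ℤ × ℤ) (hs : sqCube s ∉ Q) :
    ConnectedComponents ((⋃₀ Q)ᶜ : Set (ℝ × ℝ)) :=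
  ConnectedComponents.mk ⟨ctr s, ctr_mem_U hQ hs⟩

theorem mk_eq_cmp (hQ : IsCubicalComplex Q) (p : ((⋃₀ Q)ᶜ : Set (ℝ × ℝ))) {s : ℤ × ℤ}
    (hs : p.1 ∈ sqCube s) :
    ConnectedComponents.mk p = sqComp hQ s (not_sq_of_mem p.2 hs) := by
  have h := JoinedIn.of_segment_subset (seg_sub hQ p.2 hs)
  rw [joinedIn_iff_joined p.2 (ctr_mem_U hQ (not_sq_of_mem p.2 hs))] at h
  unfold sqComp
  symm
  rw [ConnectedComponents.coe_eq_coe']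
  exact pathComponent_subset_component _ h

theorem cmp_adj (hQ : IsCubicalComplex Q) (e) (he : edgeCube e ∉ Q) :
    sqComp hQ (prevSq e) (fun h => he (edge_mem_of_prevSq hQ h)) =
      sqComp hQ e.1 (fun h => he (edge_mem_of_sq hQ h)) := by
  obtain ⟨m, hm, hme⟩ : ∃ m, m ∈ (⋃₀ Q)ᶜ ∧ m ∈ edgeCube e := by
    obtain ⟨⟨a, b⟩, c⟩ := e
    cases c
    · refine ⟨((a : ℝ) + 1 / 2, (b : ℝ)), ?_, ?_⟩
      · rintro ⟨q, hq, hpq⟩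
        apply he
        refine hQ.2.2.1 q hq _ (isElem_edge _) ?_
        obtain ⟨E₁, E₂, hE₁, hE₂, rfl⟩ := hQ.2.1 q hq
        rw [elemInt_eq (a := a) hE₁ hpq.1 (by simp) (by simp; linarith)]
        simp only [edgeCube, hEdgeCube, Bool.false_eq_true, if_false]
        exact Set.prod_mono subset_rfl (by simpa using hpq.2)
      · simp only [edgeCube, hEdgeCube, Bool.false_eq_true, if_false]
        refine ⟨⟨?_, ?_⟩, ?_⟩ <;> simp <;> linarith
    · refine ⟨((a : ℝ), (b : ℝ) + 1 / 2), ?_, ?_⟩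
      · rintro ⟨q, hq, hpq⟩
        apply he
        refine hQ.2.2.1 q hq _ (isElem_edge _) ?_
        obtain ⟨E₁, E₂, hE₁, hE₂, rfl⟩ := hQ.2.1 q hq
        rw [elemInt_eq (a := b) hE₂ hpq.2 (by simp) (by simp; linarith)]
        simp only [edgeCube, vEdgeCube, if_true]
        exact Set.prod_mono (by simpa using hpq.1) subset_rfl
      · simp only [edgeCube, vEdgeCube, if_true]
        refine ⟨?_, ⟨?_, ?_⟩⟩ <;> simp <;> linarith
  rw [← mk_eq_cmp hQ ⟨m, hm⟩ (edge_sub_prevSq e hme), ← mk_eq_cmp hQ ⟨m, hm⟩ (edge_sub_sq e hme)]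

/-- invariance under crossing edges outside `Q` -/
def EdgeInv (Q : Set (Set (ℝ × ℝ))) (f : ℤ × ℤ → ℤ) : Prop :=
  ∀ e, edgeCube e ∉ Q → f (prevSq e) = f e.1

theorem EdgeInv.horiz {f} (hf : EdgeInv Q f) {p : ℝ × ℝ} (hp : p ∈ (⋃₀ Q)ᶜ) {a a' b : ℤ}
    (h : p ∈ sqCube (a, b)) (h' : p ∈ sqCube (a', b)) (hlt : a' < a) : f (a', b) = f (a, b) := by
  rw [mem_sqCube] at h h'
  obtain ⟨⟨h1, h2⟩, h3, h4⟩ := h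
  obtain ⟨⟨h1', h2'⟩, -, -⟩ := h'
  simp only at *
  have : (a : ℝ) ≤ a' + 1 := by linarith
  have : a ≤ a' + 1 := by exact_mod_cast this
  obtain rfl : a' = a - 1 := by omega
  have := hf ((a, b), true) (fun he => hp ⟨_, he, by
    simp only [edgeCube, vEdgeCube, if_true]
    refine ⟨?_, h3, h4⟩
    push_cast at h2'
    simp only [Set.mem_singleton_iff]
    linarith⟩)
  simpa [prevSq] using this

theorem EdgeInv.vert {f} (hf : EdgeInv Q f) {p : ℝ × ℝ} (hp : p ∈ (⋃₀ Q)ᶜ) {a b b' : ℤ}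
    (h : p ∈ sqCube (a, b)) (h' : p ∈ sqCube (a, b')) (hlt : b' < b) : f (a, b') = f (a, b) := by
  rw [mem_sqCube] at h h'
  obtain ⟨⟨h1, h2⟩, h3, h4⟩ := h
  obtain ⟨-, h3', h4'⟩ := h'
  simp only at *
  have : (b : ℝ) ≤ b' + 1 := by linarith
  have : b ≤ b' + 1 := by exact_mod_cast this
  obtain rfl : b' = b - 1 := by omega
  have := hf ((a, b), false) (fun he => hp ⟨_, he, by
    simp only [edgeCube, hEdgeCube, Bool.false_eq_true, if_false]
    refine ⟨⟨h1, h2⟩, ?_⟩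
    push_cast at h4'
    simp only [Set.mem_singleton_iff]
    linarith⟩)
  simpa [prevSq] using this

theorem EdgeInv.eq {f} (hf : EdgeInv Q f) {p : ℝ × ℝ} (hp : p ∈ (⋃₀ Q)ᶜ) {s t : ℤ × ℤ}
    (h : p ∈ sqCube s) (h' : p ∈ sqCube t) : f s = f t := by
  obtain ⟨a, b⟩ := s
  obtain ⟨c, d⟩ := t
  have h'' : p ∈ sqCube (c, b) := by
    rw [mem_sqCube] at *
    exact ⟨h'.1, h.2⟩
  trans f (c, b)
  · rcases lt_trichotomy a c with hl | rfl | hl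
    · exact hf.horiz hp h'' h hl
    · rfl
    · exact (hf.horiz hp h h'' hl).symm
  · rcases lt_trichotomy b d with hl | rfl | hl
    · exact hf.vert hp h' h'' hl
    · rfl
    · exact (hf.vert hp h'' h' hl).symm

/-- square containing a point -/
noncomputable def flr (p : ℝ × ℝ) : ℤ × ℤ := (⌊p.1⌋, ⌊p.2⌋)

theorem mem_flr (p) : p ∈ sqCube (flr p) := by
  rw [mem_sqCube]
  exact ⟨⟨Int.floor_le _, (Int.lt_floor_add_one _).le⟩, Int.floor_le _,
    (Int.lt_floor_add_one _).le⟩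

theorem eventually_floor (x : ℝ) : ∀ᶠ y in nhds x, (⌊y⌋ : ℝ) ≤ x ∧ x ≤ ⌊y⌋ + 1 := by
  have h1 : ∀ᶠ y : ℝ in nhds x, y < (⌊x⌋ : ℝ) + 1 := eventually_lt_nhds (Int.lt_floor_add_one x)
  have h2 : ∀ᶠ y : ℝ in nhds x, (⌈x⌉ : ℝ) - 1 < y :=
    eventually_gt_nhds (by linarith [Int.ceil_lt_add_one x])
  filter_upwards [h1, h2] with y hy1 hy2
  have h3 : ⌊y⌋ ≤ ⌊x⌋ := by
    have : ⌊y⌋ < ⌊x⌋ + 1 := Int.floor_lt.2 (by exact_mod_cast hy1)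
    omega
  have h4 : ⌈x⌉ - 1 ≤ ⌊y⌋ := Int.le_floor.2 (by push_cast; exact hy2.le)
  have h3' : (⌊y⌋ : ℝ) ≤ ⌊x⌋ := by exact_mod_cast h3
  have h4' : (⌈x⌉ : ℝ) - 1 ≤ ⌊y⌋ := by exact_mod_cast h4
  exact ⟨h3'.trans (Int.floor_le x), by linarith [Int.le_ceil x]⟩

theorem eventually_flr (p : ℝ × ℝ) : ∀ᶠ q in nhds p, p ∈ sqCube (flr q) := by
  have h1 := (continuous_fst.tendsto p).eventually (eventually_floor p.1)
  have h2 := (continuous_snd.tendsto p).eventually (eventually_floor p.2)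
  filter_upwards [h1, h2] with q h1 h2
  exact mem_sqCube.2 ⟨h1, h2⟩

theorem EdgeInv.exists_lift (hQ : IsCubicalComplex Q) {f} (hf : EdgeInv Q f) :
    ∃ φ : ConnectedComponents ((⋃₀ Q)ᶜ : Set (ℝ × ℝ)) → ℤ,
      ∀ s hs, φ (sqComp hQ s hs) = f s := by
  have hc : IsLocallyConstant (fun p : ((⋃₀ Q)ᶜ : Set (ℝ × ℝ)) => f (flr p.1)) := by
    rw [IsLocallyConstant.iff_eventually_eq]
    intro p
    have := (continuous_subtype_val.tendsto p).eventually (eventually_flr p.1)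
    filter_upwards [this] with q hq
    exact hf.eq p.2 hq (mem_flr _)
  refine ⟨hc.continuous.connectedComponentsLift, fun s hs => ?_⟩
  unfold sqComp
  erw [Continuous.connectedComponentsLift_apply_coe]
  exact hf.eq (ctr_mem_U hQ hs) (mem_flr _) (ctr_mem s)

theorem exists_box {S : Set (ℝ × ℝ)} (hS : Bornology.IsBounded S) :
    ∃ N : ℤ, ∀ s : ℤ × ℤ, (∃ p ∈ S, p ∈ sqCube s) → |s.1| ≤ N ∧ |s.2| ≤ N := by
  obtain ⟨R, hR⟩ := hS.exists_norm_le
  refine ⟨⌈R⌉ + 1, ?_⟩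
  rintro s ⟨p, hp, hps⟩
  have h := hR p hp
  rw [Prod.norm_def, sup_le_iff, Real.norm_eq_abs, Real.norm_eq_abs, abs_le, abs_le] at h
  rw [mem_sqCube] at hps
  have hc := Int.le_ceil R
  obtain ⟨⟨h1, h2⟩, h3, h4⟩ := hps
  obtain ⟨⟨h1', h2'⟩, h3', h4'⟩ := h
  rw [abs_le, abs_le]
  refine ⟨⟨?_, ?_⟩, ?_, ?_⟩ <;> rify <;> linarith

theorem box_finite (N : ℤ) : {s : ℤ × ℤ | |s.1| ≤ N ∧ |s.2| ≤ N}.Finite := by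
  apply ((Set.finite_Icc (-N) N).prod (Set.finite_Icc (-N) N)).subset
  rintro ⟨a, b⟩ ⟨h1, h2⟩
  exact ⟨abs_le.1 h1, abs_le.1 h2⟩

theorem bdd_sq (s) : Bornology.IsBounded (sqCube s) :=
  (Metric.isBounded_Icc _ _).prod (Metric.isBounded_Icc _ _)

/-- boundedness of a component -/
abbrev BddC (c : ConnectedComponents ((⋃₀ Q)ᶜ : Set (ℝ × ℝ))) : Prop :=
  Bornology.IsBounded (Subtype.val '' (ConnectedComponents.mk ⁻¹' {c}))

theorem finite_of_bdd (hQ : IsCubicalComplex Q) {c : ConnectedComponents ((⋃₀ Q)ᶜ : Set (ℝ × ℝ))}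
    (hc : BddC c) : {s | ∃ hs, sqComp hQ s hs = c}.Finite := by
  obtain ⟨N, hN⟩ := exists_box hc
  apply (box_finite N).subset
  rintro s ⟨hs, h⟩
  exact hN s ⟨ctr s, ⟨⟨ctr s, ctr_mem_U hQ hs⟩, h, rfl⟩, ctr_mem s⟩

theorem bdd_of_finite (hQ : IsCubicalComplex Q) {c : ConnectedComponents ((⋃₀ Q)ᶜ : Set (ℝ × ℝ))}
    (hc : {s | ∃ hs, sqComp hQ s hs = c}.Finite) : BddC c := by
  apply ((Bornology.isBounded_biUnion hc (f := sqCube)).2 (fun s _ => bdd_sq s)).subset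
  rintro _ ⟨p, hp, rfl⟩
  simp only [Set.mem_iUnion]
  exact ⟨flr p.1, ⟨not_sq_of_mem p.2 (mem_flr _), by
    rw [← mk_eq_cmp hQ p (mem_flr _)]; exact hp⟩, mem_flr _⟩

theorem exists_sqComp (hQ : IsCubicalComplex Q) (c : ConnectedComponents ((⋃₀ Q)ᶜ : Set (ℝ × ℝ))) :
    ∃ s hs, sqComp hQ s hs = c := by
  obtain ⟨p, rfl⟩ := ConnectedComponents.surjective_coe c
  exact ⟨flr p.1, not_sq_of_mem p.2 (mem_flr _), (mk_eq_cmp hQ p (mem_flr _)).symm⟩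

theorem exists_edge_box (hQ : IsCubicalComplex Q) :
    ∃ N : ℤ, ∀ e, edgeCube e ∈ Q → |e.1.1| ≤ N ∧ |e.1.2| ≤ N := by
  have hb : Bornology.IsBounded (⋃₀ Q) := by
    rw [Bornology.isBounded_sUnion hQ.1]
    intro q hq
    obtain ⟨E₁, E₂, hE₁, hE₂, rfl⟩ := hQ.2.1 q hq
    have : ∀ E, IsElementaryInterval E → Bornology.IsBounded E := by
      rintro E ⟨e, rfl | rfl⟩
      · exact Metric.isBounded_Icc _ _
      · exact Bornology.isBounded_singleton
    exact (this _ hE₁).prod (this _ hE₂)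
  obtain ⟨N, hN⟩ := exists_box hb
  refine ⟨N, fun e he => hN _ ?_⟩
  refine ⟨((e.1.1 : ℝ), (e.1.2 : ℝ)), ⟨_, he, ?_⟩, mem_sqCube.2 (by simp)⟩
  unfold edgeCube hEdgeCube vEdgeCube
  split_ifs <;> simp

theorem finite_edges (hQ : IsCubicalComplex Q) : Finite {e // edgeCube e ∈ Q} := by
  obtain ⟨N, hN⟩ := exists_edge_box hQ
  apply Set.Finite.to_subtype (s := {e | edgeCube e ∈ Q})
  apply ((box_finite N).prod (Set.finite_univ (α := Bool))).subset
  intro e he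
  exact ⟨hN e he, trivial⟩

theorem finite_squares (hQ : IsCubicalComplex Q) : Finite {s // sqCube s ∈ Q} := by
  obtain ⟨N, hN⟩ := exists_edge_box hQ
  apply Set.Finite.to_subtype (s := {s | sqCube s ∈ Q})
  apply (box_finite N).subset
  intro s hs
  exact hN (s, true) (edge_mem_of_sq (e := (s, true)) hQ hs)

/-- bounded components -/
abbrev BC (Q : Set (Set (ℝ × ℝ))) : Type :=
  {c : ConnectedComponents ((⋃₀ Q)ᶜ : Set (ℝ × ℝ)) //
        Bornology.IsBounded (Subtype.val '' (ConnectedComponents.mk ⁻¹' {c}))}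

/-- 2-chain attached to a function on bounded components -/
noncomputable def fg (hQ : IsCubicalComplex Q) (g : BC Q →₀ ℤ) (s : ℤ × ℤ) : ℤ :=
  if hs : sqCube s ∉ Q then extz g (sqComp hQ s hs) else 0

theorem fg_not (hQ : IsCubicalComplex Q) (g : BC Q →₀ ℤ) {s : ℤ × ℤ} (hs : sqCube s ∉ Q) :
    fg hQ g s = extz g (sqComp hQ s hs) := by
  simp only [fg, dif_pos hs]

theorem fg_finite (hQ : IsCubicalComplex Q) (g : BC Q →₀ ℤ) : {s | fg hQ g s ≠ 0}.Finite := by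
  have : (⋃ c ∈ g.support, {s | ∃ hs, sqComp hQ s hs = c.1}).Finite :=
    Set.Finite.biUnion g.support.finite_toSet (fun c _ => finite_of_bdd hQ c.2)
  apply this.subset
  intro s hs
  by_cases h : sqCube s ∉ Q
  · simp only [Set.mem_ofPred_eq, fg, dif_pos h, extz] at hs
    split_ifs at hs with hb
    · simp only [Set.mem_iUnion]
      exact ⟨⟨_, hb⟩, Finsupp.mem_support_iff.2 hs, h, rfl⟩
    · exact absurd rfl hs
  · simp only [Set.mem_ofPred_eq, fg, dif_neg h] at hs
    exact absurd rfl hs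

theorem fg_inv (hQ : IsCubicalComplex Q) (g : BC Q →₀ ℤ) : EdgeInv Q (fg hQ g) := by
  intro e he
  rw [fg_not hQ g (fun h => he (edge_mem_of_prevSq hQ h)),
    fg_not hQ g (fun h => he (edge_mem_of_sq hQ h)), cmp_adj hQ e he]

theorem dl_fg_not (hQ : IsCubicalComplex Q) (g : BC Q →₀ ℤ) {e} (he : edgeCube e ∉ Q) :
    dl (fg hQ g) e = 0 := by
  rw [dl_eq, fg_inv hQ g e he]; simp

theorem dl_add (f g : ℤ × ℤ → ℤ) (e) : dl (fun s => f s + g s) e = dl f e + dl g e := by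
  unfold dl; split_ifs <;> ring

theorem dl_sub (f g : ℤ × ℤ → ℤ) (e) : dl (fun s => f s - g s) e = dl f e - dl g e := by
  unfold dl; split_ifs <;> ring

theorem dl_smul (n : ℤ) (g : ℤ × ℤ → ℤ) (e) : dl (fun s => n * g s) e = n * dl g e := by
  unfold dl; split_ifs <;> ring

/-- the cycle attached to a function on bounded components -/
noncomputable def cyc (hQ : IsCubicalComplex Q) : (BC Q →₀ ℤ) →ₗ[ℤ] D1 Q :=
  haveI := finite_edges hQ
  { toFun := fun g => Finsupp.equivFunOnFinite.symm (fun e => dl (fg hQ g) e.1)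
    map_add' := by
      intro x y
      ext e
      have : fg hQ (x + y) = fun s => fg hQ x s + fg hQ y s := by
        funext s
        unfold fg
        split_ifs
        · simp
        · rw [extz_add]
      simp [this, dl_add]
    map_smul' := by
      intro n y
      ext e
      have : fg hQ (n • y) = fun s => n * fg hQ y s := by
        funext s
        unfold fg
        split_ifs
        · simp
        · rw [extz_smul]
      simp [this, dl_smul] }

theorem extz_cyc (hQ : IsCubicalComplex Q) (g : BC Q →₀ ℤ) (e) :
    extz (cyc hQ g) e = dl (fg hQ g) e := by
  by_cases he : edgeCube e ∈ Q
  · simp [extz, he, cyc]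
  · rw [dl_fg_not hQ g he, extz_not (P := fun e => edgeCube e ∈ Q) _ _ he]

theorem cyc_mem (hQ : IsCubicalComplex Q) (g : BC Q →₀ ℤ) :
    cyc hQ g ∈ LinearMap.ker (bd1 Q) := by
  rw [LinearMap.mem_ker, mem_ker_bd1 hQ]
  intro p
  rw [show extz (cyc hQ g) = dl (fg hQ g) from funext (extz_cyc hQ g)]
  exact dl1_dl _ p

/-- the comparison map -/
noncomputable def toH1 (hQ : IsCubicalComplex Q) : (BC Q →₀ ℤ) →ₗ[ℤ] H1 Q :=
  (Submodule.mkQ _).comp ((cyc hQ).codRestrict _ (cyc_mem hQ))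

theorem toH1_inj (hQ : IsCubicalComplex Q) : Function.Injective (toH1 hQ) := by
  rw [← LinearMap.ker_eq_bot, LinearMap.ker_eq_bot']
  intro g hg
  have hg' : cyc hQ g ∈ LinearMap.range (bd2 Q) := by
    simpa [toH1, Submodule.Quotient.mk_eq_zero] using hg
  obtain ⟨y, hy⟩ := hg'
  have h0 : ∀ e, dl (fun s => fg hQ g s - extz y s) e = 0 := by
    intro e
    rw [dl_sub, ← extz_cyc, ← extz_bd2' hQ, hy, sub_self]
  have hfin : ({s | fg hQ g s ≠ 0} ∪ {s | sqCube s ∈ Q}).Finite :=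
    (fg_finite hQ g).union (Set.finite_coe_iff.1 (finite_squares hQ))
  obtain ⟨t, ht⟩ := hfin.exists_notMem
  simp only [Set.mem_union, Set.mem_ofPred_eq, not_or, not_not] at ht
  have heq : ∀ s, fg hQ g s = extz y s := by
    intro s
    have := dl_eq_zero _ h0 s t
    simp only [ht.1, extz_not y t ht.2] at this
    linarith
  apply extz_inj
  intro c hc
  obtain ⟨s, hs, rfl⟩ := exists_sqComp hQ c
  rw [← fg_not hQ g hs, heq, extz_not y s hs, extz_zero]

theorem toH1_surj (hQ : IsCubicalComplex Q) : Function.Surjective (toH1 hQ) := by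
  intro w
  obtain ⟨⟨z, hz⟩, rfl⟩ := Submodule.mkQ_surjective _ w
  have hz' := (mem_ker_bd1 hQ z).1 hz
  obtain ⟨N, hN⟩ := exists_edge_box hQ
  obtain ⟨f, hf, hfz⟩ := exists_primitive (extz z) N (by
    intro e he
    apply hN
    by_contra h
    exact he (extz_not (P := fun e => edgeCube e ∈ Q) _ _ h)) hz'
  have hfin : {s | f s ≠ 0}.Finite := (box_finite N).subset hf
  have hinv : EdgeInv Q f := by
    intro e he
    have := hfz e
    rw [extz_not (P := fun e => edgeCube e ∈ Q) _ _ he, dl_eq] at this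
    split_ifs at this <;> linarith
  obtain ⟨φ, hφ⟩ := hinv.exists_lift hQ
  have hsupp : (Function.support fun c : BC Q => φ c.1).Finite := by
    have h1 : {c | φ c ≠ 0}.Finite := by
      choose σ hσ hσc using exists_sqComp hQ
      have hinj : Function.Injective σ := by
        intro c c' h
        rw [← hσc c, ← hσc c']
        congr 1
      apply (hfin.preimage hinj.injOn).subset
      intro c hc
      have h2 := hφ (σ c) (hσ c)
      rw [hσc c] at h2
      change f (σ c) ≠ 0
      rw [← h2]
      exact hc
    exact h1.preimage Subtype.val_injective.injOn
  set g : BC Q →₀ ℤ := Finsupp.ofSupportFinite _ hsupp with hg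
  have hfg : ∀ s, sqCube s ∉ Q → fg hQ g s = f s := by
    intro s hs
    rw [fg_not hQ g hs]
    unfold extz
    split_ifs with hb
    · exact hφ s hs
    · by_contra hne
      apply hb
      apply bdd_of_finite hQ
      apply hfin.subset
      rintro t ⟨ht, htc⟩
      change f t ≠ 0
      rw [← hφ t ht, htc, hφ s hs]
      exact fun h => hne h.symm
  haveI := finite_squares hQ
  let y : D2 Q := Finsupp.equivFunOnFinite.symm (fun s => f s.1 - fg hQ g s.1)
  have hy : extz y = fun s => f s - fg hQ g s := by
    funext s
    by_cases hs : sqCube s ∈ Q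
    · simp [extz, hs, y]
    · rw [extz_not (P := fun s => sqCube s ∈ Q) _ _ hs, hfg s hs, sub_self]
  have hbd : bd2 Q y = z - cyc hQ g := by
    apply extz_inj
    intro e _
    rw [extz_bd2' hQ, hy, dl_sub, extz_sub, extz_cyc, hfz]
  refine ⟨g, ?_⟩
  symm
  rw [← sub_eq_zero]
  change Submodule.mkQ _ _ - Submodule.mkQ _ _ = 0
  rw [← map_sub, Submodule.mkQ_apply, Submodule.Quotient.mk_eq_zero]
  exact ⟨y, hbd⟩

end

/-- For every cubical complex `Q` in `ℝ²`, the rank of the first homology group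
`H₁(Q) = ker ∂₁ / im ∂₂` (the rank of a finitely generated abelian group `A` being
`dim_ℚ (ℚ ⊗_ℤ A)`) equals the number of bounded connected components (enclosed
regions) of the complement `ℝ² \ |Q|`, where `|Q| = ⋃ q ∈ Q, q`. -/
theorem rank_H1_eq_card_boundedComponents (Q : Set (Set (ℝ × ℝ)))
    (hQ : IsCubicalComplex Q) :
    Module.rank ℚ (ℚ ⊗[ℤ] H1 Q) =
      Cardinal.mk {c : ConnectedComponents ((⋃₀ Q)ᶜ : Set (ℝ × ℝ)) //
        Bornology.IsBounded (Subtype.val '' (ConnectedComponents.mk ⁻¹' {c}))} := by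
  have e := LinearEquiv.ofBijective (toH1 hQ) ⟨toH1_inj hQ, toH1_surj hQ⟩
  have b : Module.Basis (BC Q) ℤ (H1 Q) := ⟨e.symm⟩
  exact (Module.Basis.mk_eq_rank'' (b.baseChange ℚ)).symm
end
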